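/- The theta multiplier λ(r) := m(r)·β̃(r)⁻¹ on Γ_θ is given explicitly as follows: λ(r) = (2c/d)·ε_d⁻¹ if r = (a,b;c,d) ∈ Γ(2); and λ(r) = (2c/d)·ε_d⁻¹·e^{−iπ/4}·(−c,d)_ℝ if r = (a,b;c,d)·ω ∈ Γ(2)·ω, where in the second case (a,b;c,d) denotes the Γ(2)-factor of r and ω = (0,−1;1,0). -/

import Mathlib

noncomputable section

/-- The real Hilbert symbol `(a,b)_ℝ`. -/
def hilb (a b : ℝ) : ℝ := if a < 0 ∧ b < 0 then -1 else 1

/-- The function `m(g)` on `SL₂(ℝ)`. -/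
def mX (g : Matrix (Fin 2) (Fin 2) ℝ) : ℂ :=
  if g 1 0 = 0 then
    Complex.exp (Complex.I * (Real.pi : ℂ) / 4 * ((1 : ℂ) - (Real.sign (g 1 1) : ℂ)))
  else Complex.exp (-(Complex.I * (Real.pi : ℂ) / 4) * (Real.sign (g 1 0) : ℂ))

def toR (g : Matrix (Fin 2) (Fin 2) ℤ) : Matrix (Fin 2) (Fin 2) ℝ := g.map fun x => (x : ℝ)

/-- The symplectic Gauss sum `G(d, c)`. -/
def gaussG (d c : ℤ) : ℂ :=
  (((c.natAbs : ℝ) ^ (-(1 : ℝ) / 2) : ℝ) : ℂ) *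
    ∑ n ∈ Finset.range c.natAbs,
      Complex.exp (-(Real.pi : ℂ) * Complex.I * (d : ℂ) * (n : ℂ) ^ 2 / (c : ℂ))

/-- `β̃(g)` on `Γ_θ`. -/
def betaTilde (g : Matrix (Fin 2) (Fin 2) ℤ) : ℂ :=
  if g 1 0 = 0 then 1 else gaussG (g 1 1) (g 1 0)

/-- The theta multiplier `λ(g) := m(g) · β̃(g)⁻¹`. -/
def lamTheta (g : Matrix (Fin 2) (Fin 2) ℤ) : ℂ := mX (toR g) * (betaTilde g)⁻¹

def kronTwo (a : ℤ) : ℤ :=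
  if a % 2 = 0 then 0 else if a % 8 = 1 ∨ a % 8 = 7 then 1 else -1

/-- The Kronecker symbol `(a/n)`, with the conventions `(0/1) = 1` and `(0/(-1)) = -1`. -/
def kron (a n : ℤ) : ℤ :=
  if n = 0 then (if a = 1 ∨ a = -1 then 1 else 0)
  else if a = 0 then (if n = 1 then 1 else if n = -1 then -1 else 0)
  else (if n < 0 ∧ a < 0 then -1 else 1) *
    kronTwo a ^ (n.natAbs.factorization 2) *
    jacobiSym a (n.natAbs / 2 ^ (n.natAbs.factorization 2))

/-- `ε_d` for odd integers `d`. -/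
def epsD (d : ℤ) : ℂ := if d % 4 = 1 then 1 else Complex.I

open Filter Topology

/-- unnormalised quadratic Gauss sum -/
def Ssum (p : ℤ) (q : ℕ) : ℂ :=
  ∑ n ∈ Finset.range q, Complex.exp (Real.pi * Complex.I * p * (n : ℂ) ^ 2 / q)

lemma exp_shift (p : ℤ) (q : ℕ) (hq : 0 < q) (h : Even (p * q)) (n : ℤ) (k : ℕ) :
    Complex.exp (Real.pi * Complex.I * p * ((k : ℂ) + n * q) ^ 2 / q) =
      Complex.exp (Real.pi * Complex.I * p * (k : ℂ) ^ 2 / q) := by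
  obtain ⟨m, hm⟩ := h
  have hm' : (p : ℂ) * q = m + m := by exact_mod_cast hm
  have hq' : (q : ℂ) ≠ 0 := by exact_mod_cast hq.ne'
  rw [Complex.exp_eq_exp_iff_exists_int]
  refine ⟨p * k * n + m * n ^ 2, ?_⟩
  push_cast
  field_simp
  linear_combination (n : ℂ) ^ 2 * q * hm'

lemma theta_inner (q : ℕ) (hq : 0 < q) (k : ℕ) (w : ℂ) (hw : 0 < w.im) :
    HasSum (fun n : ℤ => Complex.exp (Real.pi * Complex.I * ((k : ℂ) + n * q) ^ 2 * w))
     (1 / (-Complex.I * (q ^ 2 * w)) ^ (1 / 2 : ℂ) *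
       jacobiTheta₂ (k / q) (-1 / (q ^ 2 * w))) := by
  have hq' : (q : ℂ) ≠ 0 := by exact_mod_cast hq.ne'
  have hw0 : w ≠ 0 := by rintro rfl; simp at hw
  have him : 0 < ((q : ℂ) ^ 2 * w).im := by
    have : ((q : ℂ) ^ 2 * w).im = (q : ℝ) ^ 2 * w.im := by
      rw [show (q : ℂ) ^ 2 = (((q : ℝ) ^ 2 : ℝ) : ℂ) by push_cast; rfl, Complex.im_ofReal_mul]
    rw [this]; positivity
  have h := (hasSum_jacobiTheta₂_term (q * k * w) him).mul_left
    (Complex.exp (Real.pi * Complex.I * k ^ 2 * w))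
  rw [jacobiTheta₂_functional_equation] at h
  refine (congrArg₂ (fun f x => HasSum (α := ℂ) (β := ℤ) f x) ?_ ?_).mpr h
  · funext n
    rw [jacobiTheta₂_term, ← Complex.exp_add]
    congr 1
    ring
  · have e1 : (q * k * w / (q ^ 2 * w) : ℂ) = k / q := by field_simp
    have e2 : Complex.exp (-Real.pi * Complex.I * (q * k * w) ^ 2 / (q ^ 2 * w)) *
      Complex.exp (Real.pi * Complex.I * k ^ 2 * w) = 1 := by
      rw [← Complex.exp_add, ← Complex.exp_zero]
      congr 1
      field_simp
      ring
    rw [e1]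
    linear_combination -(1 / (-Complex.I * (q ^ 2 * w)) ^ (1 / 2 : ℂ) *
       jacobiTheta₂ (k / q) (-1 / (q ^ 2 * w))) * e2

lemma theta_split (p : ℤ) (q : ℕ) (hq : 0 < q) (h : Even (p * q)) (w : ℂ) (hw : 0 < w.im) :
    (-Complex.I * (q ^ 2 * w)) ^ (1 / 2 : ℂ) * jacobiTheta (p / q + w) =
      ∑ k ∈ Finset.range q, Complex.exp (Real.pi * Complex.I * p * (k : ℂ) ^ 2 / q) *
        jacobiTheta₂ (k / q) (-1 / (q ^ 2 * w)) := by
  have hq' : (q : ℂ) ≠ 0 := by exact_mod_cast hq.ne'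
  have hw0 : w ≠ 0 := by rintro rfl; simp at hw
  have : NeZero q := ⟨hq.ne'⟩
  have hne : (-Complex.I * (q ^ 2 * w)) ^ (1 / 2 : ℂ) ≠ 0 := by
    rw [Ne, Complex.cpow_eq_zero_iff, not_and_or]
    left
    simp [hq', hw0]
  have him : 0 < ((p / q + w : ℂ)).im := by
    have : ((p / q : ℂ)).im = 0 := by
      rw [show (p / q : ℂ) = ((p / q : ℝ) : ℂ) by push_cast; rfl, Complex.ofReal_im]
    rw [Complex.add_im, this]; simpa using hw
  have h1 := hasSum_jacobiTheta₂_term 0 him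
  rw [← jacobiTheta_eq_jacobiTheta₂] at h1
  have h2 := ((Equiv.prodComm (Fin q) ℤ).trans (Int.divModEquiv q).symm).hasSum_iff.mpr h1
  have h3 := h2.prod_fiberwise (g := fun k : Fin q =>
     Complex.exp (Real.pi * Complex.I * p * ((k : ℕ) : ℂ) ^ 2 / q) *
     (1 / (-Complex.I * (q ^ 2 * w)) ^ (1 / 2 : ℂ) *
       jacobiTheta₂ ((k : ℕ) / q) (-1 / (q ^ 2 * w)))) (by
    intro k
    have := (theta_inner q hq k w hw).mul_left
      (Complex.exp (Real.pi * Complex.I * p * ((k : ℕ) : ℂ) ^ 2 / q))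
    refine this.congr_fun ?_ |> fun h => h
    intro n
    simp only [Function.comp, Equiv.trans_apply, Equiv.prodComm_apply, Prod.swap,
      Int.divModEquiv_symm_apply, jacobiTheta₂_term]
    rw [← exp_shift p q hq h n k, ← Complex.exp_add]
    congr 1
    push_cast
    field_simp
    ring)
  have h4 := h3.unique (hasSum_fintype _)
  rw [h4, Fin.sum_univ_eq_sum_range (fun k : ℕ => 
     Complex.exp (Real.pi * Complex.I * p * (k : ℂ) ^ 2 / q) *
     (1 / (-Complex.I * (q ^ 2 * w)) ^ (1 / 2 : ℂ) *
       jacobiTheta₂ (k / q) (-1 / (q ^ 2 * w)))), Finset.mul_sum]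
  refine Finset.sum_congr rfl fun k _ => ?_
  generalize (-Complex.I * (q ^ 2 * w)) ^ (1 / 2 : ℂ) = X at hne
  generalize jacobiTheta₂ (k / q) (-1 / (q ^ 2 * w)) = Y
  generalize Complex.exp (Real.pi * Complex.I * p * (k : ℂ) ^ 2 / q) = Z
  field_simp

lemma theta2_tendsto {l : Filter ℝ} (x : ℝ) (τ : ℝ → ℂ)
    (h : Tendsto (fun t => (τ t).im) l atTop) :
    Tendsto (fun t => jacobiTheta₂ x (τ t)) l (𝓝 1) := by
  have key : Tendsto (fun t => ∑' n : ℤ, jacobiTheta₂_term n x (τ t)) l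
      (𝓝 (∑' n : ℤ, if n = 0 then (1 : ℂ) else 0)) := by
    refine tendsto_tsum_of_dominated_convergence
      (bound := fun n : ℤ => ‖jacobiTheta₂_term n 0 Complex.I‖) ?_ ?_ ?_
    · exact ((summable_jacobiTheta₂_term_iff 0 Complex.I).mpr (by simp)).norm
    · intro n
      split_ifs with hn
      · subst hn; simpa [jacobiTheta₂_term] using tendsto_const_nhds
      · rw [tendsto_zero_iff_norm_tendsto_zero]
        simp only [norm_jacobiTheta₂_term, Complex.ofReal_im, mul_zero, sub_zero]
        refine Real.tendsto_exp_atBot.comp ?_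
        refine Tendsto.const_mul_atTop_of_neg ?_ h
        have : (0 : ℝ) < (n : ℝ) ^ 2 := by positivity
        nlinarith [Real.pi_pos]
    · filter_upwards [h.eventually_ge_atTop 1] with t ht n
      simp only [norm_jacobiTheta₂_term, Complex.ofReal_im, mul_zero, sub_zero]
      apply Real.exp_le_exp.mpr
      simp only [Complex.I_im, Complex.zero_im, mul_zero, sub_zero, mul_one]
      have : 0 ≤ Real.pi * (n : ℝ) ^ 2 := by positivity
      nlinarith
  simpa [jacobiTheta₂] using key

lemma theta_asym (p : ℤ) (q : ℕ) (hq : 0 < q) (h : Even (p * q)) {l : Filter ℝ} (w : ℝ → ℂ)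
    (hw : ∀ᶠ t in l, 0 < (w t).im)
    (hi : Tendsto (fun t => (-1 / (q ^ 2 * w t)).im) l atTop) :
    Tendsto (fun t => (-Complex.I * (q ^ 2 * w t)) ^ (1 / 2 : ℂ) * jacobiTheta (p / q + w t)) l
      (𝓝 (Ssum p q)) := by
  have : Tendsto (fun t => ∑ k ∈ Finset.range q,
      Complex.exp (Real.pi * Complex.I * p * (k : ℂ) ^ 2 / q) *
        jacobiTheta₂ (k / q) (-1 / (q ^ 2 * w t))) l (𝓝 (Ssum p q)) := by
    unfold Ssum
    refine tendsto_finsetSum _ fun k _ => ?_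
    have h1 := (theta2_tendsto (k / q : ℝ) _ hi).const_mul
      (Complex.exp (Real.pi * Complex.I * p * (k : ℂ) ^ 2 / q))
    simpa using h1
  refine this.congr' ?_
  filter_upwards [hw] with t ht
  exact (theta_split p q hq h _ ht).symm

lemma cpow_half_mul (r : ℝ) (hr : 0 < r) (z : ℂ) (hz : z ≠ 0) :
    ((r : ℂ) * z) ^ (1 / 2 : ℂ) = (r : ℂ) ^ (1 / 2 : ℂ) * z ^ (1 / 2 : ℂ) := by
  have hr' : (r : ℂ) ≠ 0 := by exact_mod_cast hr.ne'
  rw [Complex.cpow_def_of_ne_zero (mul_ne_zero hr' hz), Complex.cpow_def_of_ne_zero hr',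
    Complex.cpow_def_of_ne_zero hz, ← Complex.exp_add, Complex.log_ofReal_mul hr hz,
    Complex.ofReal_log hr.le]
  congr 1
  ring

lemma Ssum_recip (p q : ℕ) (hp : 0 < p) (hq : 0 < q) (h : Even (p * q)) :
    Ssum (-q) p = (-Complex.I * (p / q)) ^ (1 / 2 : ℂ) * Ssum p q := by
  have hq' : (q : ℂ) ≠ 0 := by exact_mod_cast hq.ne'
  have hp' : (p : ℂ) ≠ 0 := by exact_mod_cast hp.ne'
  have hqr : (0 : ℝ) < q := by exact_mod_cast hq
  have hpr : (0 : ℝ) < p := by exact_mod_cast hp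
  have hz : ∀ t : ℝ, (1 + Complex.I * t * q / p : ℂ) ≠ 0 := by
    intro t ht
    have := congrArg Complex.re ht
    rw [show (1 + Complex.I * t * q / p : ℂ) = 1 + ((t * q / p : ℝ) : ℂ) * Complex.I by
      push_cast; ring] at this
    simp at this
  have hτ0 : ∀ t : ℝ, 0 < t → (p / q + Complex.I * t : ℂ) ≠ 0 := by
    intro t ht h0
    apply hz t
    have : (p / q + Complex.I * t : ℂ) * (q / p) = 1 + Complex.I * t * q / p := by field_simp
    rw [← this, h0, zero_mul]
  let w2 : ℝ → ℂ := fun t => Complex.I * t * (q / p) ^ 2 / (1 + Complex.I * t * q / p)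
  have hinv : ∀ t : ℝ, 0 < t → (-1 / (p ^ 2 * w2 t) : ℂ) =
      ((-1 / (p * q) : ℝ) : ℂ) + ((1 / (q ^ 2 * t) : ℝ) : ℂ) * Complex.I := by
    intro t ht
    have ht' : (t : ℂ) ≠ 0 := by exact_mod_cast ht.ne'
    have := hz t
    have h3 : (p + Complex.I * t * q : ℂ) ≠ 0 := by
      intro h0; apply this; field_simp; simpa using h0
    simp only [w2]
    push_cast
    field_simp
    linear_combination (-(p : ℂ)) * Complex.I_sq
  have hpos : ∀ᶠ t : ℝ in 𝓝[>] 0, 0 < t := eventually_mem_nhdsWithin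
  have hw2im : ∀ t : ℝ, 0 < t → 0 < (w2 t).im := by
    intro t ht
    have e : w2 t = ((t * (q / p) ^ 2 : ℝ) : ℂ) * (Complex.I * (1 + Complex.I * t * q / p)⁻¹) := by
      simp only [w2]; push_cast; field_simp
    rw [e, Complex.im_ofReal_mul]
    refine mul_pos (by positivity) ?_
    rw [Complex.I_mul_im, Complex.inv_re]
    refine div_pos ?_ (Complex.normSq_pos.mpr (hz t))
    rw [show (1 + Complex.I * t * q / p : ℂ) = 1 + ((t * q / p : ℝ) : ℂ) * Complex.I by
      push_cast; ring]
    simp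
  have A1 := theta_asym p q hq (by exact_mod_cast h) (l := 𝓝[>] (0 : ℝ)) (fun t => Complex.I * t)
    (by filter_upwards [hpos] with t ht; simpa using ht)
    (by
      have : Tendsto (fun t : ℝ => ((q : ℝ) ^ 2)⁻¹ * t⁻¹) (𝓝[>] 0) atTop :=
        tendsto_inv_nhdsGT_zero.const_mul_atTop (by positivity)
      refine this.congr' ?_
      filter_upwards [hpos] with t ht
      have ht' : (t : ℂ) ≠ 0 := by exact_mod_cast ht.ne'
      have : (-1 / (q ^ 2 * (Complex.I * t)) : ℂ) =
         ((((q : ℝ) ^ 2)⁻¹ * t⁻¹ : ℝ) : ℂ) * Complex.I := by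
        push_cast; field_simp; simp
      rw [this, Complex.im_ofReal_mul, Complex.I_im, mul_one])
  have A2 := theta_asym (-q) p hp (by rw [neg_mul, even_neg, mul_comm]; exact_mod_cast h)
    (l := 𝓝[>] (0 : ℝ)) w2
    (by filter_upwards [hpos] with t ht; exact hw2im t ht)
    (by
      have : Tendsto (fun t : ℝ => ((q : ℝ) ^ 2)⁻¹ * t⁻¹) (𝓝[>] 0) atTop :=
        tendsto_inv_nhdsGT_zero.const_mul_atTop (by positivity)
      refine this.congr' ?_
      filter_upwards [hpos] with t ht
      rw [hinv t ht, Complex.add_im, Complex.ofReal_im, Complex.im_ofReal_mul, Complex.I_im]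
      rw [zero_add, mul_one, one_div, mul_inv])
  have B : Tendsto (fun t : ℝ => ((1 + Complex.I * t * q / p)⁻¹ : ℂ) ^ (1 / 2 : ℂ) *
      (-Complex.I * (p / q + Complex.I * t)) ^ (1 / 2 : ℂ)) (𝓝[>] (0 : ℝ))
      (𝓝 ((-Complex.I * (p / q)) ^ (1 / 2 : ℂ))) := by
    have c1 : ContinuousAt (fun t : ℝ => ((1 + Complex.I * t * q / p)⁻¹ : ℂ) ^ (1 / 2 : ℂ)) 0 := by
      refine ContinuousAt.cpow ?_ continuousAt_const ?_
      · refine ContinuousAt.inv₀ ?_ (hz 0)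
        fun_prop
      · simp
    have c2 : ContinuousAt (fun t : ℝ => 
        (-Complex.I * (p / q + Complex.I * t)) ^ (1 / 2 : ℂ)) 0 := by
      refine ContinuousAt.cpow (by fun_prop) continuousAt_const ?_
      right
      rw [show (-Complex.I * (p / q + Complex.I * (0 : ℝ)) : ℂ) = ((-(p / q) : ℝ) : ℂ) * Complex.I by
        push_cast; ring, Complex.im_ofReal_mul, Complex.I_im]
      have : (0 : ℝ) < p / q := by positivity
      linarith
    have := (c1.mul c2).tendsto.mono_left (nhdsWithin_le_nhds (s := Set.Ioi (0 : ℝ)))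
    simpa [Pi.mul_def] using this
  have C := B.mul A1
  refine tendsto_nhds_unique A2 (C.congr' ?_)
  filter_upwards [hpos] with t ht
  have ht' : (t : ℂ) ≠ 0 := by exact_mod_cast ht.ne'
  have hzt := hz t
  have hτ := hτ0 t ht
  have hτim : 0 < (p / q + Complex.I * t : ℂ).im := by
    rw [show (p / q + Complex.I * t : ℂ) = ((p / q : ℝ) : ℂ) + (t : ℂ) * Complex.I by
      push_cast; ring]
    simpa using ht
  have h3 : (p + Complex.I * t * q : ℂ) ≠ 0 := by
    intro h0; apply hzt; field_simp; simpa using h0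
  have hS := jacobiTheta_S_smul ⟨_, hτim⟩
  rw [UpperHalfPlane.modular_S_smul] at hS
  simp only at hS
  have earg : ((-q : ℤ) : ℂ) / p + w2 t = (-(p / q + Complex.I * t))⁻¹ := by
    simp only [w2]
    have h4 : (p / q + Complex.I * t : ℂ) = (p + Complex.I * t * q) / q := by field_simp
    have h5 : (1 + Complex.I * t * q / p : ℂ) = (p + Complex.I * t * q) / p := by field_simp
    rw [h4, h5]
    generalize hX : (p + Complex.I * t * q : ℂ) = X at h3
    push_cast
    rw [← neg_div, inv_div, div_div_eq_mul_div]
    rw [div_pow, div_add_div _ _ hp' h3, div_eq_div_iff (mul_ne_zero hp' h3) (neg_ne_zero.mpr h3)]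
    field_simp
    linear_combination -hX
  rw [earg, hS]
  have e5 : (-Complex.I * (p ^ 2 * w2 t)) = (((q ^ 2 * t : ℝ)) : ℂ) * (1 + Complex.I * t * q / p)⁻¹ := by
    simp only [w2]
    push_cast
    field_simp
    linear_combination -Complex.I_sq
  have e6 : (-Complex.I * (q ^ 2 * (Complex.I * t)) : ℂ) = ((q ^ 2 * t : ℝ) : ℂ) := by
    push_cast
    linear_combination (-(q : ℂ) ^ 2 * t) * Complex.I_sq
  rw [e5, e6, cpow_half_mul _ (by positivity) _ (inv_ne_zero hzt)]
  push_cast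
  ring

lemma Ssum_congr (p p' : ℤ) (q : ℕ) (h : (2 * q : ℤ) ∣ p - p') : Ssum p q = Ssum p' q := by
  obtain ⟨m, hm⟩ := h
  unfold Ssum
  refine Finset.sum_congr rfl fun k hk => ?_
  have hq : 0 < q := by have := Finset.mem_range.mp hk; omega
  have hq' : (q : ℂ) ≠ 0 := by exact_mod_cast hq.ne'
  have hm' : (p : ℂ) - p' = 2 * q * m := by exact_mod_cast hm
  rw [Complex.exp_eq_exp_iff_exists_int]
  refine ⟨m * k ^ 2, ?_⟩
  push_cast
  field_simp
  linear_combination (k : ℂ) ^ 2 * hm'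

lemma Ssum_neg (p : ℤ) (q : ℕ) : Ssum (-p) q = (starRingEnd ℂ) (Ssum p q) := by
  unfold Ssum
  rw [map_sum]
  refine Finset.sum_congr rfl fun k _ => ?_
  rw [← Complex.exp_conj]
  congr 1
  simp

/-- normalised Gauss sum -/
def Fg (p : ℤ) (q : ℕ) : ℂ := ((√(q : ℝ))⁻¹ : ℝ) * Ssum p q

lemma Fg_congr (p p' : ℤ) (q : ℕ) (h : (2 * q : ℤ) ∣ p - p') : Fg p q = Fg p' q := by
  rw [Fg, Fg, Ssum_congr p p' q h]

lemma Fg_neg (p : ℤ) (q : ℕ) : Fg (-p) q = (starRingEnd ℂ) (Fg p q) := by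
  rw [Fg, Fg, Ssum_neg, map_mul, Complex.conj_ofReal]

lemma conj_four : (starRingEnd ℂ) 4 = 4 := Complex.conj_ofNat 4

/-- the primitive eighth root of unity -/
def z8 : ℂ := Complex.exp (Complex.I * Real.pi / 4)

lemma z8_conj_mul : (starRingEnd ℂ) z8 * z8 = 1 := by
  rw [z8, ← Complex.exp_conj, ← Complex.exp_add, ← Complex.exp_zero]
  congr 1
  simp [conj_four]
  ring

lemma z8_sq : z8 * z8 = Complex.I := by
  have := Complex.exp_pi_div_two_mul_I
  rw [z8, ← Complex.exp_add]
  refine Eq.trans ?_ this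
  congr 1
  ring

lemma z8_neg : Complex.exp (-(Complex.I * Real.pi / 4)) = (starRingEnd ℂ) z8 := by
  rw [z8, ← Complex.exp_conj]
  congr 1
  simp [conj_four, neg_div]

lemma negI_half : (-Complex.I) ^ (1 / 2 : ℂ) = (starRingEnd ℂ) z8 := by
  rw [Complex.cpow_def_of_ne_zero (by simp), Complex.log_neg_I, ← z8_neg]
  congr 1
  ring

lemma Fg_recip (p q : ℕ) (hp : 0 < p) (hq : 0 < q) (h : Even (p * q)) :
    Fg (-q) p = (starRingEnd ℂ) z8 * Fg p q := by
  have hqr : (0 : ℝ) < q := by exact_mod_cast hq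
  have hpr : (0 : ℝ) < p := by exact_mod_cast hp
  rw [Fg, Fg, Ssum_recip p q hp hq h]
  have e : (-Complex.I * (p / q) : ℂ) = ((p / q : ℝ) : ℂ) * (-Complex.I) := by push_cast; ring
  have e2 : ((p / q : ℝ) : ℂ) ^ (1 / 2 : ℂ) = ((√p / √q : ℝ) : ℂ) := by
    rw [← Real.sqrt_div hpr.le, Real.sqrt_eq_rpow, Complex.ofReal_cpow (by positivity)]
    norm_num
  rw [e, cpow_half_mul _ (by positivity) _ (by simp), negI_half, e2]
  have : √(p : ℝ) ≠ 0 := by positivity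
  have h1 : ((√(p : ℝ))⁻¹ : ℝ) * (√p / √q) = (√(q : ℝ))⁻¹ := by field_simp
  rw [← h1]
  push_cast
  ring

lemma jac_refl (n q q' k : ℕ) (hn : 0 < n) (hq : Odd q) (hq' : Odd q') (h : q + q' = 4 * n * k) :
    jacobiSym n q = jacobiSym n q' := by
  have h1 : Odd (4 * n - 1) := ⟨2 * n - 1, by omega⟩
  have h2 : jacobiSym n (4 * n - 1) = 1 := by
    have a : jacobiSym (4 * n : ℤ) (4 * n - 1) = 1 := by
      rw [jacobiSym.mod_left' (a₂ := 1), jacobiSym.one_left]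
      refine (Int.modEq_iff_dvd.mpr ⟨-1, ?_⟩ : (4 * n : ℤ) ≡ 1 [ZMOD ((4 * n - 1 : ℕ) : ℤ)])
      push_cast [show 1 ≤ 4 * n by omega]
      ring
    rw [jacobiSym.mul_left, jacobiSym.at_four h1, one_mul] at a
    exact a
  have h3 : jacobiSym n (q' * (4 * n - 1)) = jacobiSym n q' := by
    rw [jacobiSym.mul_right' _ hq'.pos.ne' h1.pos.ne', h2, mul_one]
  rw [← h3, jacobiSym.mod_right' n hq, jacobiSym.mod_right' n (hq'.mul h1)]
  congr 1
  change Nat.ModEq (4 * n) _ _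
  rw [← Int.natCast_modEq_iff]
  apply Int.modEq_iff_dvd.mpr
  have h' : (q : ℤ) + q' = 4 * n * k := by exact_mod_cast h
  refine ⟨q' - k, ?_⟩
  push_cast [show 1 ≤ 4 * n by omega]
  linear_combination -h'

lemma Fg_odd (q : ℕ) : Odd q → ∀ a : ℤ, Int.gcd a q = 1 →
    Fg (2 * a) q = (jacobiSym a q : ℂ) * epsD q := by
  induction q using Nat.strong_induction_on with
  | _ q ih =>
  intro hq
  -- the positive reduced case
  have pos : ∀ n : ℕ, 2 * n < q → Int.gcd n q = 1 →
      Fg (2 * n) q = (jacobiSym n q : ℂ) * epsD q := by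
    intro n hn hg
    rcases Nat.eq_zero_or_pos n with rfl | hn0
    · have : q = 1 := by simpa using hg
      subst this
      simp [Fg, Ssum, epsD]
    have hev : Even (2 * n * q) := ⟨n * q, by ring⟩
    have r1 := Fg_recip (2 * n) q (by omega) hq.pos hev
    have r2 : Fg (2 * n) q = z8 * Fg (-q) (2 * n) := by
      rw [r1]
      push_cast
      linear_combination (-Fg (2 * n) q) * z8_conj_mul
    have hdm := Nat.div_add_mod q (4 * n)
    have hlt := Nat.mod_lt q (show 0 < 4 * n by omega)
    have hrodd : Odd (q % (4 * n)) := hq.mod_even ⟨2 * n, by ring⟩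
    have hne : q % (4 * n) ≠ 2 * n := by
      intro h; rw [h] at hrodd; exact absurd hrodd (by simp)
    set r := q % (4 * n) with hr
    set k := q / (4 * n) with hk
    clear_value r k
    have hZ : (4 * n * k + r : ℤ) = q := by exact_mod_cast hdm
    have hmod4 : (4 * n * k : ℤ) % 4 = 0 := by
      rw [mul_assoc]; exact Int.mul_emod_right _ _
    rcases lt_or_gt_of_ne hne with hlt2 | hgt2
    · have hgr : Int.gcd n r = 1 := by
        rw [← hg, ← hZ]
        rw [show (4 * n * k + r : ℤ) = r + n * (4 * k) by ring, Int.gcd_add_mul_left_right]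
      have := ih r (by omega) hrodd n hgr
      have r3 := Fg_recip (2 * n) r (by omega) hrodd.pos ⟨n * r, by ring⟩
      rw [r2, Fg_congr (-q) (-r) (2 * n) ⟨-k, by push_cast; linear_combination hZ⟩, r3]
      push_cast
      rw [this, ← mul_assoc, mul_comm z8, z8_conj_mul, one_mul, jacobiSym.mod_right' n hq, ← hr]
      have : (q : ℤ) % 4 = r % 4 := by omega
      simp only [epsD, this]
    · obtain ⟨s, hs⟩ : ∃ s, s + r = 4 * n := ⟨4 * n - r, by omega⟩
      have hsodd : Odd s := by
        rw [Nat.odd_iff] at *; omega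
      have hsZ : (s + r : ℤ) = 4 * n := by exact_mod_cast hs
      have hgr : Int.gcd n s = 1 := by
        rw [← hg, ← hZ, show (s : ℤ) = -r + n * 4 by linear_combination hsZ,
          show (4 * n * k + r : ℤ) = r + n * (4 * k) by ring, Int.gcd_add_mul_left_right,
          Int.gcd_add_mul_left_right, Int.gcd_neg]
      have := ih s (by omega) hsodd n hgr
      have r3 := Fg_recip (2 * n) s (by omega) hsodd.pos ⟨n * s, by ring⟩
      have r4 : Fg s (2 * n) = (starRingEnd ℂ) (Fg (-s) (2 * n)) := by
        rw [← Fg_neg, neg_neg]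
      rw [r2, Fg_congr (-q) s (2 * n) ⟨-(k + 1), by push_cast; linear_combination hZ - hsZ⟩,
        r4, r3]
      push_cast
      rw [this, jac_refl n q s (k + 1) hn0 hq hsodd (by rw [← hdm]; linarith), map_mul,
        Complex.conj_conj, ← mul_assoc, z8_sq, map_mul]
      have hq2 : (q : ℤ) % 2 = 1 := by have := Nat.odd_iff.mp hq; omega
      have hqs : ((q : ℤ) % 4 = 1 ∧ (s : ℤ) % 4 = 3) ∨ ((q : ℤ) % 4 = 3 ∧ (s : ℤ) % 4 = 1) := by
        omega
      rcases hqs with ⟨h1, h2⟩ | ⟨h1, h2⟩ <;> simp [epsD, h1, h2]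
      · linear_combination (-(jacobiSym n s : ℂ)) * Complex.I_sq
      · ring
  intro a hg
  have hb1 := Int.bmod_lt (x := a) (m := q) hq.pos
  have hb2 := Int.le_bmod (x := a) (m := q) hq.pos
  obtain ⟨t, ht⟩ : (q : ℤ) ∣ a - a.bmod q := by
    exact Int.ModEq.dvd (Int.bmod_emod ..)
  have hgb : Int.gcd (a.bmod q) q = 1 := by
    have e : a = a.bmod q + q * t := by linear_combination ht
    have := hg
    rw [e, Int.gcd_add_mul_left_left] at this
    exact this
  have hJ : jacobiSym a q = jacobiSym (a.bmod q) q :=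
    jacobiSym.mod_left' (Int.bmod_emod ..).symm
  rw [Fg_congr (2 * a) (2 * a.bmod q) q ⟨t, by linear_combination 2 * ht⟩, hJ]
  have hq2 := Nat.odd_iff.mp hq
  generalize a.bmod q = b at *
  obtain ⟨n, rfl | rfl⟩ := Int.eq_nat_or_neg b
  · exact pos n (by omega) hgb
  · rw [show (2 * -(n : ℤ)) = -(2 * n) by ring, Fg_neg, pos n (by omega) (by simpa using hgb),
      ← neg_one_mul (n : ℤ), jacobiSym.mul_left, jacobiSym.at_neg_one hq, map_mul]
    have hq4 : q % 4 = 1 ∨ q % 4 = 3 := by omega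
    rcases hq4 with h | h
    · have h' : (q : ℤ) % 4 = 1 := by omega
      simp [epsD, h', ZMod.χ₄_nat_one_mod_four h]
    · have h' : (q : ℤ) % 4 = 3 := by omega
      simp [epsD, h', ZMod.χ₄_nat_three_mod_four h]

lemma gaussG_pos (d : ℤ) (C : ℕ) : gaussG d C = Fg (-d) C := by
  unfold gaussG Fg Ssum
  congr 1
  · rw [Int.natAbs_natCast, Real.sqrt_eq_rpow, ← Real.rpow_neg (by positivity), neg_div]
  · rw [Int.natAbs_natCast]
    refine Finset.sum_congr rfl fun k _ => ?_
    congr 1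
    push_cast
    ring

lemma gaussG_neg (d : ℤ) (C : ℕ) : gaussG d (-C) = Fg d C := by
  rw [← neg_neg d, ← gaussG_pos]
  unfold gaussG
  rw [Int.natAbs_neg]
  congr 1
  refine Finset.sum_congr rfl fun k _ => ?_
  congr 1
  push_cast
  rw [div_neg]
  ring

lemma mX_pos (r : Matrix (Fin 2) (Fin 2) ℤ) (h : 0 < r 1 0) :
    mX (toR r) = (starRingEnd ℂ) z8 := by
  have h1 : (0 : ℝ) < toR r 1 0 := by simpa [toR] using h
  rw [mX, if_neg h1.ne', Real.sign_of_pos h1, ← z8_neg]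
  simp

lemma mX_neg (r : Matrix (Fin 2) (Fin 2) ℤ) (h : r 1 0 < 0) :
    mX (toR r) = z8 := by
  have h1 : toR r 1 0 < (0 : ℝ) := by simpa [toR] using h
  rw [mX, if_neg h1.ne, Real.sign_of_neg h1, z8]
  simp

lemma kron_odd (e d : ℤ) (he : e ≠ 0) (hd : Odd d) :
    kron (2 * (2 * e)) d = (if d < 0 ∧ e < 0 then -1 else 1) * jacobiSym e d.natAbs := by
  have hd0 : d ≠ 0 := by rintro rfl; simp at hd
  have hodd : Odd d.natAbs := Int.natAbs_odd.mpr hd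
  have hf : d.natAbs.factorization 2 = 0 := by
    apply Nat.factorization_eq_zero_of_not_dvd
    rw [← even_iff_two_dvd, Nat.not_even_iff_odd]; exact hodd
  have h2 : ¬ (2 * (2 * e) = 0) := by omega
  rw [kron, if_neg hd0, if_neg h2, hf, pow_zero, pow_zero, Nat.div_one, mul_one,
    show 2 * (2 * e) = 4 * e by ring, jacobiSym.mul_left, jacobiSym.at_four hodd, one_mul]
  congr 1
  have : (4 * e < 0) ↔ e < 0 := by omega
  simp only [this]

lemma jac_neg (n : ℤ) (q : ℕ) (hq : Odd q) :
    jacobiSym (-n) q = (if (q : ℤ) % 4 = 1 then 1 else -1) * jacobiSym n q := by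
  rw [← neg_one_mul n, jacobiSym.mul_left, jacobiSym.at_neg_one hq]
  have h2 := Nat.odd_iff.mp hq
  have hq4 : q % 4 = 1 ∨ q % 4 = 3 := by omega
  rcases hq4 with h | h
  · have h' : (q : ℤ) % 4 = 1 := by omega
    simp [h', ZMod.χ₄_nat_one_mod_four h]
  · have h' : (q : ℤ) % 4 = 3 := by omega
    simp [h', ZMod.χ₄_nat_three_mod_four h]

lemma z8_inv : z8⁻¹ = (starRingEnd ℂ) z8 := inv_eq_of_mul_eq_one_left z8_conj_mul

lemma conj_z8_inv : ((starRingEnd ℂ) z8)⁻¹ = z8 := by rw [← z8_inv, inv_inv]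

lemma z8_conj_sq : (starRingEnd ℂ) z8 * (starRingEnd ℂ) z8 = -Complex.I := by
  rw [← map_mul, z8_sq, Complex.conj_I]

lemma z8_mul_conj : z8 * (starRingEnd ℂ) z8 = 1 := by rw [mul_comm, z8_conj_mul]

lemma Fg_even (n q : ℕ) (hn : 0 < n) (hq : Odd q) (hg : Int.gcd n q = 1) :
    Fg (-q) (2 * n) = (starRingEnd ℂ) z8 * ((jacobiSym n q : ℂ) * epsD q) := by
  rw [Fg_recip (2 * n) q (by omega) hq.pos ⟨n * q, by ring⟩]
  push_cast
  rw [Fg_odd q hq n hg]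

lemma Fg_even' (n q : ℕ) (hn : 0 < n) (hq : Odd q) (hg : Int.gcd n q = 1) :
    Fg q (2 * n) = z8 * ((jacobiSym n q : ℂ) * (starRingEnd ℂ) (epsD q)) := by
  have := Fg_neg (-q) (2 * n)
  rw [neg_neg, Fg_even n q hn hq hg] at this
  rw [this]
  simp

lemma coprime_of_det (r : Matrix (Fin 2) (Fin 2) ℤ) (h : r.det = 1) (e : ℤ) (he : r 1 0 = 2 * e) :
    Int.gcd e (r 1 1) = 1 := by
  rw [Matrix.det_fin_two, he] at h
  apply Int.isCoprime_iff_gcd_eq_one.mp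
  exact ⟨-(2 * r 0 1), r 0 0, by linarith⟩

lemma lam_A (r : Matrix (Fin 2) (Fin 2) ℤ) (h : r.det = 1) (he : Even (r 1 0)) (hd : Odd (r 1 1)) :
      lamTheta r = (kron (2 * r 1 0) (r 1 1) : ℂ) * (epsD (r 1 1))⁻¹ := by
  obtain ⟨e, he'⟩ := he
  have he : r 1 0 = 2 * e := by omega
  have hg := coprime_of_det r h e he
  rcases eq_or_ne e 0 with rfl | he0
  · have hc : r 1 0 = 0 := by simpa using he
    have hd1 : r 1 1 = 1 ∨ r 1 1 = -1 := by
      rw [Int.gcd_zero_left] at hg; omega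
    have hc' : toR r 1 0 = 0 := by simp [toR, hc]
    rw [lamTheta, mX, if_pos hc', betaTilde, if_pos hc, he]
    rcases hd1 with h1 | h1
    · have : toR r 1 1 = 1 := by simp [toR, h1]
      rw [this, h1]
      simp [kron, epsD]
    · have : toR r 1 1 = -1 := by simp [toR, h1]
      rw [this, h1, Real.sign_of_neg (by norm_num)]
      simp [kron, epsD]
      refine Eq.trans ?_ z8_sq
      rw [z8, ← Complex.exp_add]
      congr 1
      ring
  rw [he, kron_odd e _ he0 hd]
  have hc0 : r 1 0 ≠ 0 := by omega
  rw [lamTheta, betaTilde, if_neg hc0]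
  have hodd : Odd (r 1 1).natAbs := Int.natAbs_odd.mpr hd
  generalize hD : r 1 1 = d at *
  obtain ⟨q, hq⟩ := Int.eq_nat_or_neg d
  have hqodd : Odd q := by rcases hq with rfl | rfl <;> simpa using hodd
  have hq2 := Nat.odd_iff.mp hqodd
  have hq0 : (0 : ℤ) < q := by omega
  have hq4 : (q : ℤ) % 4 = 1 ∨ (q : ℤ) % 4 = 3 := by omega
  obtain ⟨n, hn⟩ := Int.eq_nat_or_neg e
  have hn0 : 0 < n := by omega
  have hg' : Int.gcd n q = 1 := by
    rcases hq with rfl | rfl <;> rcases hn with rfl | rfl <;> simpa using hg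
  have F1 := Fg_even n q hn0 hqodd hg'
  have F2 := Fg_even' n q hn0 hqodd hg'
  have hJ := jacobiSym.eq_one_or_neg_one hg'
  have hnZ : (0 : ℤ) < n := by omega
  have k1 := z8_conj_mul
  have k2 := z8_sq
  have k3 := z8_conj_sq
  have k4 := Complex.I_mul_I
  rcases hn with rfl | rfl
  · rw [mX_pos r (by omega), he, show (2 * (n : ℤ)) = ((2 * n : ℕ) : ℤ) by push_cast; rfl,
      gaussG_pos]
    rcases hq with rfl | rfl
    · rw [F1]
      have e1 : ¬ ((q : ℤ) < 0 ∧ (n : ℤ) < 0) := by omega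
      rcases hJ with hJ | hJ <;> rcases hq4 with h4 | h4 <;>
        simp only [Int.natAbs_natCast, Int.natAbs_neg, hJ, epsD, h4, e1, if_true, if_false] <;>
        simp [z8_inv, conj_z8_inv] <;> grind
    · rw [neg_neg, F2]
      have e1 : ¬ (-(q : ℤ) < 0 ∧ (n : ℤ) < 0) := by omega
      have e2 : (-(q : ℤ)) % 4 = 4 - q % 4 := by omega
      rcases hJ with hJ | hJ <;> rcases hq4 with h4 | h4 <;>
        simp only [Int.natAbs_natCast, Int.natAbs_neg, hJ, epsD, h4, e1, if_true, if_false, e2] <;>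
        simp [z8_inv, conj_z8_inv] <;> grind
  · rw [mX_neg r (by omega), he, show (2 * -(n : ℤ)) = -((2 * n : ℕ) : ℤ) by push_cast; ring,
      gaussG_neg]
    rcases hq with rfl | rfl
    · rw [F2, Int.natAbs_natCast, jac_neg _ _ hqodd]
      have e1 : ¬ ((q : ℤ) < 0 ∧ -(n : ℤ) < 0) := by omega
      rcases hJ with hJ | hJ <;> rcases hq4 with h4 | h4 <;>
        simp only [Int.natAbs_natCast, Int.natAbs_neg, hJ, epsD, h4, e1, if_true, if_false] <;>
        simp [z8_inv, conj_z8_inv] <;> grind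
    · rw [F1, Int.natAbs_neg, Int.natAbs_natCast, jac_neg _ _ hqodd]
      have e1 : (-(q : ℤ) < 0 ∧ -(n : ℤ) < 0) := by omega
      have e2 : (-(q : ℤ)) % 4 = 4 - q % 4 := by omega
      rcases hJ with hJ | hJ <;> rcases hq4 with h4 | h4 <;>
        simp only [Int.natAbs_natCast, Int.natAbs_neg, hJ, epsD, h4, e1, if_true, if_false, e2] <;>
        simp [z8_inv, conj_z8_inv] <;> grind

lemma lam_B (r : Matrix (Fin 2) (Fin 2) ℤ) (h : r.det = 1) (he : Even (r 1 0)) (hd : Odd (r 1 1)) :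
      lamTheta (r * !![(0 : ℤ), -1; 1, 0]) =
        (kron (2 * r 1 0) (r 1 1) : ℂ) * (epsD (r 1 1))⁻¹ *
          Complex.exp (-(Complex.I * (Real.pi : ℂ)) / 4) *
          (hilb (-(r 1 0 : ℝ)) (r 1 1 : ℝ) : ℂ) := by
  obtain ⟨e, he'⟩ := he
  have he : r 1 0 = 2 * e := by omega
  have hg := coprime_of_det r h e he
  have hB0 : (r * !![(0 : ℤ), -1; 1, 0]) 1 0 = r 1 1 := by
    simp [Matrix.mul_apply, Fin.sum_univ_two]
  have hB1 : (r * !![(0 : ℤ), -1; 1, 0]) 1 1 = -r 1 0 := by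
    simp [Matrix.mul_apply, Fin.sum_univ_two]
  have hd0 : r 1 1 ≠ 0 := by intro h0; rw [h0] at hd; simp at hd
  rw [neg_div, z8_neg, lamTheta, betaTilde, hB0, hB1, if_neg hd0]
  have hh : hilb (-(r 1 0 : ℝ)) (r 1 1 : ℝ) = if 0 < e ∧ r 1 1 < 0 then -1 else 1 := by
    have a1 : (-(r 1 0 : ℝ)) < 0 ↔ 0 < e := by
      rw [neg_lt_zero, Int.cast_pos, he]; omega
    simp only [hilb, a1, Int.cast_lt_zero]
  rw [hh]
  have hm : mX (toR (r * !![(0 : ℤ), -1; 1, 0])) =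
      if 0 < r 1 1 then (starRingEnd ℂ) z8 else z8 := by
    split_ifs with h1
    · exact mX_pos _ (by rw [hB0]; exact h1)
    · exact mX_neg _ (by rw [hB0]; omega)
  rw [hm, he]
  clear hm hh hB0 hB1 he he'
  have hodd : Odd (r 1 1).natAbs := Int.natAbs_odd.mpr hd
  generalize hD : r 1 1 = d at *
  obtain ⟨q, hq⟩ := Int.eq_nat_or_neg d
  have hqodd : Odd q := by rcases hq with rfl | rfl <;> simpa using hodd
  have hq2 := Nat.odd_iff.mp hqodd
  have hq0 : (0 : ℤ) < q := by omega
  have hq4 : (q : ℤ) % 4 = 1 ∨ (q : ℤ) % 4 = 3 := by omega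
  rcases eq_or_ne e 0 with rfl | he0
  · have hq1 : q = 1 := by
      rw [Int.gcd_zero_left] at hg; omega
    subst hq1
    rcases hq with rfl | rfl
    · rw [gaussG_pos]
      simp [kron, epsD, Fg, Ssum]
    · rw [gaussG_neg]
      simp [kron, epsD, Fg, Ssum]
      grind [z8_conj_mul, z8_sq, z8_conj_sq, Complex.I_mul_I]
  rw [kron_odd e _ he0 hd]
  obtain ⟨n, hn⟩ := Int.eq_nat_or_neg e
  have hn0 : 0 < n := by omega
  have hg' : Int.gcd n q = 1 := by
    rcases hq with rfl | rfl <;> rcases hn with rfl | rfl <;> simpa using hg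
  have F1 := Fg_odd q hqodd n hg'
  have F2 := Fg_odd q hqodd (-n) (by simpa using hg')
  rw [jac_neg _ _ hqodd] at F2
  have hJ := jacobiSym.eq_one_or_neg_one hg'
  have hnZ : (0 : ℤ) < n := by omega
  have hI : z8 = Complex.I * (starRingEnd ℂ) z8 := by
    linear_combination (starRingEnd ℂ z8) * z8_sq - z8 * z8_conj_mul
  have e2 : (-(q : ℤ)) % 4 = 4 - q % 4 := by omega
  have e3 : ¬ ((q : ℤ) < 0) := by omega
  have e4 : ¬ ((n : ℤ) < 0) := by omega
  have e5 : (-(q : ℤ) < 0) := by omega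
  have e6 : (-(n : ℤ) < 0) := by omega
  have e7 : ¬ (0 < (-(q : ℤ))) := by omega
  have e8 : ¬ (0 < (-(n : ℤ))) := by omega
  have k1 := z8_conj_mul
  have k2 := z8_sq
  have k3 := z8_conj_sq
  have k4 := Complex.I_mul_I
  rcases hq with rfl | rfl
  · rw [gaussG_pos, neg_neg, Int.natAbs_natCast, if_pos hq0]
    rcases hn with rfl | rfl
    · rw [F1]
      rcases hJ with hJ | hJ <;> rcases hq4 with h4 | h4 <;>
        simp only [Int.natAbs_natCast, Int.natAbs_neg, hJ, epsD, h4, e3, e4, hnZ] <;> simp [mul_comm] <;> grind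
    · rw [F2, jac_neg _ _ hqodd]
      rcases hJ with hJ | hJ <;> rcases hq4 with h4 | h4 <;>
        simp only [Int.natAbs_natCast, Int.natAbs_neg, hJ, epsD, h4, e3, e6, e8] <;> simp [mul_comm] <;> grind
  · rw [gaussG_neg, Int.natAbs_neg, Int.natAbs_natCast, if_neg e7, hI]
    rcases hn with rfl | rfl
    · rw [← mul_neg, F2]
      rcases hJ with hJ | hJ <;> rcases hq4 with h4 | h4 <;>
        simp only [Int.natAbs_natCast, Int.natAbs_neg, hJ, epsD, h4, e2, e4, e5, hnZ] <;> simp [mul_comm] <;> grind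
    · rw [← mul_neg, neg_neg, F1, jac_neg _ _ hqodd]
      rcases hJ with hJ | hJ <;> rcases hq4 with h4 | h4 <;>
        simp only [Int.natAbs_natCast, Int.natAbs_neg, hJ, epsD, h4, e2, e5, e6, e8] <;> simp [mul_comm] <;> grind

theorem statement11 :
    (∀ r : Matrix (Fin 2) (Fin 2) ℤ, r.det = 1 →
      Odd (r 0 0) → Even (r 0 1) → Even (r 1 0) → Odd (r 1 1) →
      lamTheta r = (kron (2 * r 1 0) (r 1 1) : ℂ) * (epsD (r 1 1))⁻¹) ∧
    (∀ r₀ : Matrix (Fin 2) (Fin 2) ℤ, r₀.det = 1 →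
      Odd (r₀ 0 0) → Even (r₀ 0 1) → Even (r₀ 1 0) → Odd (r₀ 1 1) →
      lamTheta (r₀ * !![(0 : ℤ), -1; 1, 0]) =
        (kron (2 * r₀ 1 0) (r₀ 1 1) : ℂ) * (epsD (r₀ 1 1))⁻¹ *
          Complex.exp (-(Complex.I * (Real.pi : ℂ)) / 4) *
          (hilb (-(r₀ 1 0 : ℝ)) (r₀ 1 1 : ℝ) : ℂ)) := by
  exact ⟨fun r h _ _ he hd => lam_A r h he hd, fun r h _ _ he hd => lam_B r h he hd⟩
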